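/- Fix integers m ≥ 5 and M ≥ 2 and consider the path query Q = ⋈_{i=1}^m R_i(A_i, A_{i+1}) where every attribute has domain [mM]. Define each relation R_i as the union of m chunks, where for j ∈ [m] the j-th chunk is a subset of [(j−1)M+1, jM] × [(j−1)M+1, jM]: for every j ∈ [m] \ {i, i−1}, the j-th chunk of R_i is [(j−1)M+2, jM] × [(j−1)M+2, jM]; the i-th chunk of R_i is the single tuple ((i−1)M+1, (i−1)M+1); and the (i−1)-th chunk of R_i is empty (where for i = 1 the index i−1 is interpreted as m). Then (a) the output of Q on this instance is empty, and (b) this instance admits a certificate of size at most c · m² · M for an absolute constant c, even though every relation R_i has Θ(mM²) tuples. -/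

import Mathlib

/-! Core model of indexed natural-join queries, arguments and certificates. -/

/-- `x` is a valid index tuple for a search tree with fanout function `f` and depth
(arity) `ar`: it is nonempty, of length at most `ar`, and every coordinate is `1`-based
and within the fanout of the corresponding prefix. -/
def ValidIdx (f : List ℕ → ℕ) (ar : ℕ) (x : List ℕ) : Prop :=
  x ≠ [] ∧ x.length ≤ ar ∧
    ∀ j : Fin x.length, 1 ≤ x.get j ∧ x.get j ≤ f (x.take j.val)

/-- `v` is a valid valuation (a "database instance") for the search-tree shape `(f, ar)`:
the values assigned to the children of a common prefix strictly increase. -/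
def IsInstVal (f : List ℕ → ℕ) (ar : ℕ) (v : List ℕ → ℕ) : Prop :=
  ∀ (x : List ℕ) (i : ℕ), ValidIdx f ar (x ++ [i]) → ValidIdx f ar (x ++ [i + 1]) →
    v (x ++ [i]) < v (x ++ [i + 1])

/-- A symbolic comparison `R[x] θ S[y]` between two variables, `θ ∈ {<, =, >}`. -/
structure Comp (ι : Type) where
  R : ι
  x : List ℕ
  S : ι
  y : List ℕ
  o : Ordering
deriving DecidableEq

variable {n : ℕ} {ι : Type}

/-- The list of attributes of relation `R`, in the order of the GAO `ρ`. -/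
def attrList (attrs : ι → Finset (Fin n)) (ρ : List (Fin n)) (R : ι) : List (Fin n) :=
  ρ.filter (fun a => decide (a ∈ attrs R))

/-- The arity of relation `R`. -/
def arity (attrs : ι → Finset (Fin n)) (ρ : List (Fin n)) (R : ι) : ℕ :=
  (attrList attrs ρ R).length

/-- Well-formedness of a comparison: both index tuples are valid, and the two variables
are on the same attribute. -/
def CompWF (attrs : ι → Finset (Fin n)) (ρ : List (Fin n)) (f : ι → List ℕ → ℕ)
    (c : Comp ι) : Prop :=
  ValidIdx (f c.R) (arity attrs ρ c.R) c.x ∧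
  ValidIdx (f c.S) (arity attrs ρ c.S) c.y ∧
  (attrList attrs ρ c.R)[c.x.length - 1]? = (attrList attrs ρ c.S)[c.y.length - 1]?

/-- The valuation `v` satisfies the comparison `c`. -/
def SatComp (v : ι → List ℕ → ℕ) (c : Comp ι) : Prop :=
  compare (v c.R c.x) (v c.S c.y) = c.o

/-- `W` is a witness: one full valid index tuple per relation, all contributing to a common
output tuple `t`. -/
def IsWitness (attrs : ι → Finset (Fin n)) (ρ : List (Fin n)) (f : ι → List ℕ → ℕ)
    (v : ι → List ℕ → ℕ) (W : ι → List ℕ) : Prop :=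
  (∀ R, ValidIdx (f R) (arity attrs ρ R) (W R) ∧ (W R).length = arity attrs ρ R) ∧
  ∃ t : Fin n → ℕ, ∀ (R : ι) (j : ℕ) (a : Fin n),
    (attrList attrs ρ R)[j]? = some a → v R ((W R).take (j + 1)) = t a

/-- `A` is a certificate for the shape `f`: all its comparisons are well-formed, and any two
valuations (database instances with this index structure) satisfying all comparisons of `A`
have exactly the same witnesses. -/
def IsCert (attrs : ι → Finset (Fin n)) (ρ : List (Fin n)) (f : ι → List ℕ → ℕ)
    (A : Finset (Comp ι)) : Prop :=
  (∀ c ∈ A, CompWF attrs ρ f c) ∧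
  ∀ v v' : ι → List ℕ → ℕ,
    (∀ R, IsInstVal (f R) (arity attrs ρ R) (v R)) →
    (∀ R, IsInstVal (f R) (arity attrs ρ R) (v' R)) →
    (∀ c ∈ A, SatComp v c) → (∀ c ∈ A, SatComp v' c) →
    ∀ W, IsWitness attrs ρ f v W ↔ IsWitness attrs ρ f v' W

/-! The search tree (trie) derived from raw relational data. -/

/-- The `k`-th smallest element of a finite set of naturals (`1`-based). -/
def nthVal (s : Finset ℕ) (k : ℕ) : ℕ := (s.sort (· ≤ ·)).getD (k - 1) 0

/-- The list of values along the path of index tuple `x` in the search tree of the data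
`D` with attribute list `L`. -/
def dbValList : List ℕ → Finset (Fin n → ℕ) → List (Fin n) → List ℕ
  | [], _, _ => []
  | _ :: _, _, [] => []
  | i :: xs, D, a :: L' =>
    let w := nthVal (D.image (fun t => t a)) i
    w :: dbValList xs (D.filter (fun t => t a = w)) L'

/-- The fanout below index tuple `x` in the search tree of the data `D` with attribute
list `L`. -/
def dbFanout : List ℕ → Finset (Fin n → ℕ) → List (Fin n) → ℕ
  | _, _, [] => 0
  | [], D, a :: _ => (D.image (fun t => t a)).card
  | i :: xs, D, a :: L' =>
    let w := nthVal (D.image (fun t => t a)) i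
    dbFanout xs (D.filter (fun t => t a = w)) L'

/-- The index structure (shape) of the database `DB`, indexed consistently with the GAO
`ρ`. -/
def dbShape (attrs : ι → Finset (Fin n)) (ρ : List (Fin n))
    (DB : ι → Finset (Fin n → ℕ)) : ι → List ℕ → ℕ :=
  fun R x => dbFanout x (DB R) (attrList attrs ρ R)

/-- The value of the variable `R[x]` in the search trees of the database `DB`, indexed
consistently with the GAO `ρ`. -/
def dbValue (attrs : ι → Finset (Fin n)) (ρ : List (Fin n))
    (DB : ι → Finset (Fin n → ℕ)) : ι → List ℕ → ℕ :=
  fun R x => (dbValList x (DB R) (attrList attrs ρ R)).getD (x.length - 1) 0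

/-- The `j`-th chunk (for `j ∈ [m]`, `1`-based): the square `[(j-1)M+2, jM] × [(j-1)M+2, jM]`. -/
def chunkBlock (M j : ℕ) : Finset (ℕ × ℕ) :=
  Finset.Icc ((j - 1) * M + 2) (j * M) ×ˢ Finset.Icc ((j - 1) * M + 2) (j * M)

/-- The set of pairs of the relation `R_{i0}` (`1`-based `i0 ∈ [m]`): full chunks for every
`j ∈ [m] ∖ {i0, i0 - 1}` (where for `i0 = 1` the index `i0 - 1` is interpreted as `m`), the
single tuple `((i0-1)M+1, (i0-1)M+1)` as chunk `i0`, and an empty chunk `i0 - 1`. -/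
def pathPairs (m M i0 : ℕ) : Finset (ℕ × ℕ) :=
  ((Finset.Icc 1 m).filter
      (fun j => j ≠ i0 ∧ j ≠ (if i0 = 1 then m else i0 - 1))).biUnion
      (fun j => chunkBlock M j) ∪
    {((i0 - 1) * M + 1, (i0 - 1) * M + 1)}

/-- The attribute sets of the path query `Q = ⋈_{i=1}^m R_i(A_i, A_{i+1})`. -/
def pathAttrs (m : ℕ) : Fin m → Finset (Fin (m + 1)) := fun i => {i.castSucc, i.succ}

/-- The data of the relation `R_i` as tuples over the attributes, supported on
`{A_i, A_{i+1}}`. -/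
def pathDB (m M : ℕ) : Fin m → Finset (Fin (m + 1) → ℕ) := fun i =>
  (pathPairs m M (i.val + 1)).image
    (fun p => fun a => if a = i.castSucc then p.1 else if a = i.succ then p.2 else 0)

/-! ### Enumerating a finite set of naturals -/

lemma nthVal_eq_orderEmbOfFin (s : Finset ℕ) {k : ℕ} (h1 : 1 ≤ k) (h2 : k ≤ s.card) :
    nthVal s k = s.orderEmbOfFin rfl ⟨k - 1, by omega⟩ := by
  rw [Finset.orderEmbOfFin_apply, nthVal]
  exact List.getD_eq_getElem _ _ (by simp; omega)

lemma nthVal_mem (s : Finset ℕ) {k : ℕ} (h1 : 1 ≤ k) (h2 : k ≤ s.card) : nthVal s k ∈ s := by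
  rw [nthVal_eq_orderEmbOfFin s h1 h2]
  exact Finset.orderEmbOfFin_mem _ _ _

lemma nthVal_lt_nthVal (s : Finset ℕ) {a b : ℕ} (h1 : 1 ≤ a) (hab : a < b) (h2 : b ≤ s.card) :
    nthVal s a < nthVal s b := by
  rw [nthVal_eq_orderEmbOfFin s h1 (by omega), nthVal_eq_orderEmbOfFin s (by omega) h2]
  apply (s.orderEmbOfFin rfl).strictMono
  simp only [Fin.mk_lt_mk]
  omega

lemma exists_nthVal_eq (s : Finset ℕ) {v : ℕ} (hv : v ∈ s) :
    ∃ k, 1 ≤ k ∧ k ≤ s.card ∧ nthVal s k = v := by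
  have : v ∈ Set.range (s.orderEmbOfFin rfl) := by
    rw [Finset.range_orderEmbOfFin]; exact hv
  obtain ⟨⟨j, hj⟩, rfl⟩ := this
  refine ⟨j + 1, by omega, by omega, ?_⟩
  rw [nthVal_eq_orderEmbOfFin s (by omega) (by omega)]
  simp

/-- The number of elements of `s` below `v`. -/
def countBelow (s : Finset ℕ) (v : ℕ) : ℕ := (s.filter (· < v)).card

lemma countBelow_le_card (s : Finset ℕ) (v : ℕ) : countBelow s v ≤ s.card :=
  Finset.card_filter_le _ _

lemma countBelow_nthVal (s : Finset ℕ) {y : ℕ} (h1 : 1 ≤ y) (h2 : y ≤ s.card) :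
    countBelow s (nthVal s y) = y - 1 := by
  have himg : s.filter (· < nthVal s y) = (Finset.Ico 1 y).image (nthVal s) := by
    ext v
    simp only [Finset.mem_filter, Finset.mem_image, Finset.mem_Ico]
    constructor
    · rintro ⟨hv, hlt⟩
      obtain ⟨k, hk1, hk2, rfl⟩ := exists_nthVal_eq s hv
      refine ⟨k, ⟨hk1, ?_⟩, rfl⟩
      by_contra! hc
      rcases hc.eq_or_lt with rfl | hc
      · exact lt_irrefl _ hlt
      · exact lt_asymm hlt (nthVal_lt_nthVal s h1 hc hk2)
    · rintro ⟨k, ⟨hk1, hk2⟩, rfl⟩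
      exact ⟨nthVal_mem s hk1 (by omega), nthVal_lt_nthVal s hk1 hk2 h2⟩
  rw [countBelow, himg, Finset.card_image_of_injOn, Nat.card_Ico]
  intro a ha b hb hab
  simp only [Finset.coe_Ico, Set.mem_Ico] at ha hb
  rcases lt_trichotomy a b with h | h | h
  · exact absurd hab (nthVal_lt_nthVal s ha.1 h (by omega)).ne
  · exact h
  · exact absurd hab (nthVal_lt_nthVal s hb.1 h (by omega)).ne'

lemma nthVal_lt_iff (s : Finset ℕ) {y : ℕ} (h1 : 1 ≤ y) (h2 : y ≤ s.card) (v : ℕ) :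
    nthVal s y < v ↔ y ≤ countBelow s v := by
  constructor
  · intro h
    have hss : insert (nthVal s y) (s.filter (· < nthVal s y)) ⊆ s.filter (· < v) := by
      intro z hz
      simp only [Finset.mem_insert, Finset.mem_filter] at hz ⊢
      rcases hz with rfl | hz
      · exact ⟨nthVal_mem s h1 h2, h⟩
      · exact ⟨hz.1, hz.2.trans h⟩
    have hc := Finset.card_le_card hss
    rw [Finset.card_insert_of_notMem (by simp)] at hc
    have := countBelow_nthVal s h1 h2
    unfold countBelow at *
    omega
  · intro h
    by_contra! hc
    have hss : s.filter (· < v) ⊆ s.filter (· < nthVal s y) := by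
      intro z hz
      simp only [Finset.mem_filter] at hz ⊢
      exact ⟨hz.1, hz.2.trans_le hc⟩
    have hle := Finset.card_le_card hss
    have := countBelow_nthVal s h1 h2
    unfold countBelow at *
    omega

/-! ### The tries of binary relations -/

lemma attrList_pathAttrs (m : ℕ) (i : Fin m) :
    attrList (pathAttrs m) (List.finRange (m + 1)) i = [i.castSucc, i.succ] := by
  have h1 : (attrList (pathAttrs m) (List.finRange (m + 1)) i).Pairwise (· < ·) :=
    (List.pairwise_lt_finRange (m + 1)).filter _
  have h2 : [i.castSucc, i.succ].Pairwise (· < ·) := by simp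
  refine List.Perm.eq_of_pairwise (fun a b _ _ hab hba => absurd hab hba.asymm) h1 h2 ?_
  rw [List.perm_ext_iff_of_nodup (h1.imp ne_of_lt) (h2.imp ne_of_lt)]
  intro a
  simp [attrList, pathAttrs]

lemma arity_pathAttrs (m : ℕ) (i : Fin m) :
    arity (pathAttrs m) (List.finRange (m + 1)) i = 2 := by
  rw [arity, attrList_pathAttrs]; rfl

lemma validIdx_singleton (f : List ℕ → ℕ) (x : ℕ) :
    ValidIdx f 2 [x] ↔ 1 ≤ x ∧ x ≤ f [] := by
  simp [ValidIdx]

lemma validIdx_pair (f : List ℕ → ℕ) (x k : ℕ) :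
    ValidIdx f 2 [x, k] ↔ (1 ≤ x ∧ x ≤ f []) ∧ 1 ≤ k ∧ k ≤ f [x] := by
  simp [ValidIdx, Fin.forall_fin_two]

lemma le_of_lt_succ_on {g : ℕ → ℕ} {N : ℕ} (h : ∀ i, 1 ≤ i → i + 1 ≤ N → g i < g (i + 1))
    {a b : ℕ} (ha : 1 ≤ a) (hab : a ≤ b) (hb : b ≤ N) : g a ≤ g b := by
  induction b, hab using Nat.le_induction with
  | base => exact le_rfl
  | succ b hab ih => exact (ih (by omega)).trans (h b (by omega) hb).le

lemma IsInstVal.le_fst {f v : List ℕ → ℕ} (h : IsInstVal f 2 v) {a b : ℕ}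
    (ha : 1 ≤ a) (hab : a ≤ b) (hb : b ≤ f []) : v [a] ≤ v [b] :=
  le_of_lt_succ_on (g := fun a => v [a]) (N := f [])
    (fun i h1 h2 => h [] i ((validIdx_singleton f i).2 ⟨h1, by omega⟩)
      ((validIdx_singleton f (i + 1)).2 ⟨by omega, h2⟩)) ha hab hb

lemma IsInstVal.le_snd {f v : List ℕ → ℕ} (h : IsInstVal f 2 v) {x a b : ℕ}
    (hx : 1 ≤ x) (hx' : x ≤ f []) (ha : 1 ≤ a) (hab : a ≤ b) (hb : b ≤ f [x]) :
    v [x, a] ≤ v [x, b] :=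
  le_of_lt_succ_on (g := fun a => v [x, a]) (N := f [x])
    (fun i h1 h2 => h [x] i ((validIdx_pair f x i).2 ⟨⟨hx, hx'⟩, h1, by omega⟩)
      ((validIdx_pair f x (i + 1)).2 ⟨⟨hx, hx'⟩, by omega, h2⟩)) ha hab hb

/-! ### The chunked path instance -/

/-- The first-level values of the (`0`-based) `i`-th relation. -/
def pathFst (m M i : ℕ) : Finset ℕ := (pathPairs m M (i + 1)).image Prod.fst

/-- The values of the `i`-th relation below the first-level value `w`. -/
def pathSnd (m M i w : ℕ) : Finset ℕ :=
  ((pathPairs m M (i + 1)).filter (fun p => p.1 = w)).image Prod.snd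

lemma mem_pathFst {m M i p : ℕ} : p ∈ pathFst m M i ↔ ∃ q, (p, q) ∈ pathPairs m M (i + 1) := by
  simp [pathFst]

lemma mem_pathSnd {m M i p q : ℕ} : q ∈ pathSnd m M i p ↔ (p, q) ∈ pathPairs m M (i + 1) := by
  simp [pathSnd]

lemma card_pathSnd_pos {m M i p : ℕ} (hp : p ∈ pathFst m M i) : 1 ≤ (pathSnd m M i p).card := by
  obtain ⟨q, hq⟩ := mem_pathFst.1 hp
  exact Finset.card_pos.2 ⟨q, mem_pathSnd.2 hq⟩

lemma image_fst_pathDB (m M : ℕ) (i : Fin m) :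
    (pathDB m M i).image (fun t => t i.castSucc) = pathFst m M i := by
  rw [pathDB, Finset.image_image, pathFst]
  refine Finset.image_congr fun p _ => ?_
  simp

lemma image_snd_pathDB (m M : ℕ) (i : Fin m) (w : ℕ) :
    ((pathDB m M i).filter (fun t => t i.castSucc = w)).image (fun t => t i.succ)
      = pathSnd m M i w := by
  rw [pathDB, Finset.filter_image, Finset.image_image, pathSnd]
  have hne : i.succ ≠ i.castSucc := (Fin.castSucc_lt_succ).ne'
  simp only [if_true]
  refine Finset.image_congr fun p _ => ?_
  simp [hne]

/-- The index structure of the chunked path instance. -/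
abbrev pathShape (m M : ℕ) : Fin m → List ℕ → ℕ :=
  dbShape (pathAttrs m) (List.finRange (m + 1)) (pathDB m M)

/-- The valuation given by the chunked path instance. -/
abbrev pathValue (m M : ℕ) : Fin m → List ℕ → ℕ :=
  dbValue (pathAttrs m) (List.finRange (m + 1)) (pathDB m M)

lemma pathShape_nil (m M : ℕ) (i : Fin m) : pathShape m M i [] = (pathFst m M i).card := by
  rw [pathShape, dbShape, attrList_pathAttrs, dbFanout, image_fst_pathDB]

lemma pathShape_singleton (m M : ℕ) (i : Fin m) (x : ℕ) :
    pathShape m M i [x] = (pathSnd m M i (nthVal (pathFst m M i) x)).card := by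
  rw [pathShape, dbShape, attrList_pathAttrs]
  simp only [dbFanout]
  rw [image_fst_pathDB, image_snd_pathDB]

lemma pathValue_singleton (m M : ℕ) (i : Fin m) (x : ℕ) :
    pathValue m M i [x] = nthVal (pathFst m M i) x := by
  rw [pathValue, dbValue, attrList_pathAttrs]
  simp only [dbValList]
  rw [image_fst_pathDB]
  rfl

lemma pathValue_pair (m M : ℕ) (i : Fin m) (x k : ℕ) :
    pathValue m M i [x, k] = nthVal (pathSnd m M i (nthVal (pathFst m M i) x)) k := by
  rw [pathValue, dbValue, attrList_pathAttrs]
  simp only [dbValList]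
  rw [image_fst_pathDB, image_snd_pathDB]
  rfl

lemma mem_pathPairs {m M i p q : ℕ} :
    (p, q) ∈ pathPairs m M (i + 1) ↔
      (∃ k < m, k ≠ i ∧ k + 1 ≠ (if i = 0 then m else i) ∧
        (k * M + 2 ≤ p ∧ p ≤ k * M + M) ∧ k * M + 2 ≤ q ∧ q ≤ k * M + M) ∨
      (p = i * M + 1 ∧ q = i * M + 1) := by
  simp only [pathPairs, chunkBlock, Finset.mem_union, Finset.mem_biUnion, Finset.mem_filter,
    Finset.mem_Icc, Finset.mem_product, Finset.mem_singleton, Prod.mk.injEq,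
    Nat.add_sub_cancel, Nat.add_eq_right]
  refine or_congr ⟨?_, ?_⟩ Iff.rfl
  · rintro ⟨j, ⟨⟨hj1, hj2⟩, hj3, hj4⟩, hp, hq⟩
    obtain ⟨k, rfl⟩ : ∃ k, j = k + 1 := ⟨j - 1, by omega⟩
    rw [Nat.add_sub_cancel, Nat.succ_mul] at hp hq
    exact ⟨k, by omega, by omega, hj4, hp, hq⟩
  · rintro ⟨k, hk, hki, hk', hp, hq⟩
    refine ⟨k + 1, ⟨⟨by omega, by omega⟩, by omega, hk'⟩, ?_⟩
    rw [Nat.add_sub_cancel, Nat.succ_mul]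
    exact ⟨hp, hq⟩

lemma chunk_unique {M k l p : ℕ} (hk : k * M + 1 ≤ p) (hk' : p ≤ k * M + M)
    (hl : l * M + 1 ≤ p) (hl' : p ≤ l * M + M) : k = l := by
  have aux : ∀ a b : ℕ, a < b → a * M + M ≤ b * M := fun a b h => by
    rw [← Nat.succ_mul]; exact Nat.mul_le_mul_right M h
  rcases lt_trichotomy k l with h | h | h
  · have := aux _ _ h; omega
  · exact h
  · have := aux _ _ h; omega

/-- A path through the first-level values in which every value lies between two values below its
predecessor does not exist. -/
lemma no_interval_path {m M : ℕ} (hm : 2 ≤ m) (hM : 2 ≤ M) (p : ℕ → ℕ)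
    (hp : ∀ i < m, p i ∈ pathFst m M i)
    (hstep : ∀ i, i + 1 < m → ∃ a ∈ pathSnd m M i (p i), ∃ b ∈ pathSnd m M i (p i),
      a ≤ p (i + 1) ∧ p (i + 1) ≤ b) : False := by
  have hblock : ∀ i, i + 1 < m → ∃ k < m, k ≠ i ∧ k + 1 ≠ (if i = 0 then m else i) ∧
      (k * M + 2 ≤ p i ∧ p i ≤ k * M + M) ∧ k * M + 2 ≤ p (i + 1) ∧ p (i + 1) ≤ k * M + M := by
    intro i hi
    obtain ⟨a, ha, b, hb, hab⟩ := hstep i hi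
    rw [mem_pathSnd, mem_pathPairs] at ha hb
    obtain ⟨q, hq⟩ := mem_pathFst.1 (hp (i + 1) hi)
    rw [mem_pathPairs] at hq
    rcases ha with ⟨k, hk, hki, hk', hpk, hak⟩ | ⟨ha1, ha2⟩ <;>
      rcases hb with ⟨l, hl, hli, hl', hpl, hbl⟩ | ⟨hb1, hb2⟩
    · obtain rfl : k = l := chunk_unique (M := M) (p := p i)
        (by omega) (by omega) (by omega) (by omega)
      exact ⟨k, hk, hki, hk', hpk, by omega, by omega⟩
    · have := chunk_unique (M := M) (k := k) (l := i) (p := p i)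
        (by omega) (by omega) (by omega) (by omega)
      omega
    · have := chunk_unique (M := M) (k := l) (l := i) (p := p i)
        (by omega) (by omega) (by omega) (by omega)
      omega
    · exfalso
      have hpi : p (i + 1) = i * M + 1 := by omega
      rcases hq with ⟨l, hl, hli, hl', hpl, -⟩ | ⟨hq1, -⟩
      · obtain rfl := chunk_unique (M := M) (k := l) (l := i) (p := p (i + 1))
          (by omega) (by omega) (by omega) (by omega)
        omega
      · rw [Nat.succ_mul] at hq1
        omega
  obtain ⟨k, hk, hk0, hk0', hp0, -⟩ := hblock 0 (by omega)
  rw [if_pos rfl] at hk0'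
  have hall : ∀ i, i < m → k * M + 2 ≤ p i ∧ p i ≤ k * M + M := by
    intro i
    induction i with
    | zero => exact fun _ => hp0
    | succ i ih =>
      intro hi
      have := ih (by omega)
      obtain ⟨l, -, -, -, hl1, hl2⟩ := hblock i hi
      obtain rfl : k = l := chunk_unique (M := M) (p := p i)
        (by omega) (by omega) (by omega) (by omega)
      exact hl2
  obtain ⟨l, -, hl, -, hl1, -⟩ := hblock k (by omega)
  have := hall k hk
  exact hl (chunk_unique (M := M) (p := p k) (by omega) (by omega) (by omega) (by omega))

/-! ### The certificate -/

/-- The least value below the `x`-th first-level value. -/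
def sndMin (m M i x : ℕ) : ℕ := nthVal (pathSnd m M i (nthVal (pathFst m M i) x)) 1

/-- The fanout of the `x`-th first-level value. -/
def sndCard (m M i x : ℕ) : ℕ := (pathSnd m M i (nthVal (pathFst m M i) x)).card

/-- The greatest value below the `x`-th first-level value. -/
def sndMax (m M i x : ℕ) : ℕ :=
  nthVal (pathSnd m M i (nthVal (pathFst m M i) x)) (sndCard m M i x)

/-- The comparisons placing the values below the `x`-th first-level value of `R_i` strictly
between two first-level values of the next relation `R_{i'}`. -/
def pathCertPiece (m M : ℕ) (i i' : Fin m) (x : ℕ) : Finset (Comp (Fin m)) :=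
  (if 1 ≤ countBelow (pathFst m M i') (sndMin m M i x) then
    {⟨i, [x, 1], i', [countBelow (pathFst m M i') (sndMin m M i x)], .gt⟩} else ∅) ∪
  (if countBelow (pathFst m M i') (sndMax m M i x + 1) + 1 ≤ (pathFst m M i').card then
    {⟨i, [x, sndCard m M i x], i',
      [countBelow (pathFst m M i') (sndMax m M i x + 1) + 1], .lt⟩} else ∅)

/-- The certificate for the chunked path instance. -/
def pathCert (m M : ℕ) : Finset (Comp (Fin m)) :=
  Finset.univ.biUnion fun i : Fin m => (Finset.Icc 1 (pathFst m M i).card).biUnion fun x =>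
    if h : i.val + 1 < m then pathCertPiece m M i ⟨i.val + 1, h⟩ x else ∅

lemma mem_pathCert {m M : ℕ} {c : Comp (Fin m)} :
    c ∈ pathCert m M ↔ ∃ (i : Fin m) (x : ℕ) (h : i.val + 1 < m),
      (1 ≤ x ∧ x ≤ (pathFst m M i).card) ∧ c ∈ pathCertPiece m M i ⟨i.val + 1, h⟩ x := by
  simp only [pathCert, Finset.mem_biUnion, Finset.mem_univ, true_and, Finset.mem_Icc]
  constructor
  · rintro ⟨i, x, hx, hc⟩
    split_ifs at hc with h
    · exact ⟨i, x, h, hx, hc⟩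
    · simp at hc
  · rintro ⟨i, x, h, hx, hc⟩
    exact ⟨i, x, hx, by rwa [dif_pos h]⟩

lemma mem_pathCertPiece {m M : ℕ} {i i' : Fin m} {x : ℕ} {c : Comp (Fin m)} :
    c ∈ pathCertPiece m M i i' x ↔
      (1 ≤ countBelow (pathFst m M i') (sndMin m M i x) ∧
        c = ⟨i, [x, 1], i', [countBelow (pathFst m M i') (sndMin m M i x)], .gt⟩) ∨
      (countBelow (pathFst m M i') (sndMax m M i x + 1) + 1 ≤ (pathFst m M i').card ∧
        c = ⟨i, [x, sndCard m M i x], i',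
          [countBelow (pathFst m M i') (sndMax m M i x + 1) + 1], .lt⟩) := by
  rw [pathCertPiece, Finset.mem_union]
  refine or_congr ?_ ?_ <;> split_ifs with h <;> simp [h]

lemma card_pathFst_le {m M : ℕ} (hM : 1 ≤ M) (i : Fin m) : (pathFst m M i).card ≤ m * M := by
  have hsub : pathFst m M i ⊆ Finset.Icc 1 (m * M) := by
    intro p hp
    obtain ⟨q, hq⟩ := mem_pathFst.1 hp
    have aux : ∀ a < m, a * M + M ≤ m * M := fun a h => by
      rw [← Nat.succ_mul]; exact Nat.mul_le_mul_right M h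
    rw [Finset.mem_Icc]
    rcases mem_pathPairs.1 hq with ⟨k, hk, -, -, hpk, -⟩ | ⟨h, -⟩
    · have := aux k hk; omega
    · have := aux i i.isLt; omega
  simpa using Finset.card_le_card hsub

lemma card_pathCertPiece_le {m M : ℕ} (i i' : Fin m) (x : ℕ) :
    (pathCertPiece m M i i' x).card ≤ 2 := by
  refine (Finset.card_union_le _ _).trans ?_
  split_ifs <;> simp

lemma card_pathCert_le {m M : ℕ} (hM : 1 ≤ M) : (pathCert m M).card ≤ 2 * m ^ 2 * M := by
  have h : ∀ i ∈ (Finset.univ : Finset (Fin m)),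
      ((Finset.Icc 1 (pathFst m M i).card).biUnion fun x =>
        if h : i.val + 1 < m then pathCertPiece m M i ⟨i.val + 1, h⟩ x else ∅).card
        ≤ m * M * 2 := by
    intro i _
    refine (Finset.card_biUnion_le_card_mul _ _ 2 fun x _ => ?_).trans ?_
    · split_ifs
      · exact card_pathCertPiece_le _ _ _
      · simp
    · rw [Nat.card_Icc, Nat.add_sub_cancel]
      exact Nat.mul_le_mul_right 2 (card_pathFst_le hM i)
  refine (Finset.card_biUnion_le_card_mul _ _ _ h).trans (le_of_eq ?_)
  rw [Finset.card_univ, Fintype.card_fin]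
  ring

lemma compWF_pathCert {m M : ℕ} {c : Comp (Fin m)} (hc : c ∈ pathCert m M) :
    CompWF (pathAttrs m) (List.finRange (m + 1)) (pathShape m M) c := by
  obtain ⟨i, x, h, hx, hc⟩ := mem_pathCert.1 hc
  have hpos := card_pathSnd_pos (nthVal_mem _ hx.1 hx.2)
  rcases mem_pathCertPiece.1 hc with ⟨h1, rfl⟩ | ⟨h1, rfl⟩
  · refine ⟨?_, ?_, ?_⟩ <;> dsimp only
    · rw [arity_pathAttrs, validIdx_pair, pathShape_nil, pathShape_singleton]
      exact ⟨hx, le_rfl, hpos⟩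
    · rw [arity_pathAttrs, validIdx_singleton, pathShape_nil]
      exact ⟨h1, countBelow_le_card _ _⟩
    · rw [attrList_pathAttrs, attrList_pathAttrs]
      simp [Fin.ext_iff]
  · refine ⟨?_, ?_, ?_⟩ <;> dsimp only
    · rw [arity_pathAttrs, validIdx_pair, pathShape_nil, pathShape_singleton]
      exact ⟨hx, hpos, le_rfl⟩
    · rw [arity_pathAttrs, validIdx_singleton, pathShape_nil]
      exact ⟨by omega, h1⟩
    · rw [attrList_pathAttrs, attrList_pathAttrs]
      simp [Fin.ext_iff]

lemma satComp_pathCert {m M : ℕ} {c : Comp (Fin m)} (hc : c ∈ pathCert m M) :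
    SatComp (pathValue m M) c := by
  obtain ⟨i, x, h, hx, hc⟩ := mem_pathCert.1 hc
  rcases mem_pathCertPiece.1 hc with ⟨h1, rfl⟩ | ⟨h1, rfl⟩
  · rw [SatComp]
    dsimp only
    rw [pathValue_pair, pathValue_singleton, compare_gt_iff_gt]
    exact (nthVal_lt_iff _ h1 (countBelow_le_card _ _) _).2 le_rfl
  · rw [SatComp]
    dsimp only
    rw [pathValue_pair, pathValue_singleton, compare_lt_iff_lt]
    have := (nthVal_lt_iff _ (Nat.le_add_left 1 _) h1 (sndMax m M i x + 1)).not.2 (by omega)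
    exact Nat.lt_of_succ_le (not_lt.1 this)

/-- Under the certificate, a value below the `x`-th first-level value of `R_i` can only meet
first-level values of the next relation which lie in the same range in the chunked instance. -/
lemma nthVal_mem_range_of_satComp {m M : ℕ} {v : Fin m → List ℕ → ℕ}
    (hv : ∀ R, IsInstVal (pathShape m M R) 2 (v R))
    (hsat : ∀ c ∈ pathCert m M, SatComp v c) (i : Fin m) (hi : i.val + 1 < m) {x k y : ℕ}
    (hx1 : 1 ≤ x) (hx2 : x ≤ (pathFst m M i).card) (hk1 : 1 ≤ k) (hk2 : k ≤ sndCard m M i x)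
    (hy1 : 1 ≤ y) (hy2 : y ≤ (pathFst m M (i + 1)).card)
    (heq : v i [x, k] = v ⟨i.val + 1, hi⟩ [y]) :
    sndMin m M i x ≤ nthVal (pathFst m M (i + 1)) y ∧
      nthVal (pathFst m M (i + 1)) y ≤ sndMax m M i x := by
  have hfst : ∀ {a b}, 1 ≤ a → a ≤ b → b ≤ (pathFst m M (i + 1)).card →
      v ⟨i.val + 1, hi⟩ [a] ≤ v ⟨i.val + 1, hi⟩ [b] := fun ha hab hb =>
    (hv ⟨i.val + 1, hi⟩).le_fst ha hab (by rw [pathShape_nil]; exact hb)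
  have hsnd : ∀ {a b}, 1 ≤ a → a ≤ b → b ≤ sndCard m M i x → v i [x, a] ≤ v i [x, b] :=
    fun ha hab hb => (hv i).le_snd hx1 (by rw [pathShape_nil]; exact hx2) ha hab
      (by rw [pathShape_singleton]; exact hb)
  constructor
  · by_contra! hlt
    rw [nthVal_lt_iff _ hy1 hy2] at hlt
    have hc := hsat _ (mem_pathCert.2 ⟨i, x, hi, ⟨hx1, hx2⟩,
      mem_pathCertPiece.2 (Or.inl ⟨hy1.trans hlt, rfl⟩)⟩)
    rw [SatComp, compare_gt_iff_gt] at hc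
    dsimp only at hc
    have h1 := hfst hy1 hlt (countBelow_le_card _ _)
    have h2 := hsnd le_rfl hk1 hk2
    omega
  · by_contra! hlt
    have hlt' : ¬ nthVal (pathFst m M (i + 1)) y < sndMax m M i x + 1 := by omega
    rw [nthVal_lt_iff _ hy1 hy2, not_le] at hlt'
    have hc := hsat _ (mem_pathCert.2 ⟨i, x, hi, ⟨hx1, hx2⟩,
      mem_pathCertPiece.2 (Or.inr ⟨le_trans hlt' hy2, rfl⟩)⟩)
    rw [SatComp, compare_lt_iff_lt] at hc
    dsimp only at hc
    have h1 := hfst (Nat.le_add_left 1 _) hlt' hy2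
    have h2 := hsnd hk1 hk2 le_rfl
    omega

lemma not_isWitness_of_satComp {m M : ℕ} (hm : 2 ≤ m) (hM : 2 ≤ M) {v : Fin m → List ℕ → ℕ}
    (hv : ∀ R, IsInstVal (pathShape m M R) (arity (pathAttrs m) (List.finRange (m + 1)) R) (v R))
    (hsat : ∀ c ∈ pathCert m M, SatComp v c) (W : Fin m → List ℕ) :
    ¬ IsWitness (pathAttrs m) (List.finRange (m + 1)) (pathShape m M) v W := by
  rintro ⟨hW, t, ht⟩
  simp only [arity_pathAttrs] at hv hW
  have hpair : ∀ i : Fin m, ∃ x k, W i = [x, k] := fun i => List.length_eq_two.1 (hW i).2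
  choose x k hxk using hpair
  have hval : ∀ i : Fin m, (1 ≤ x i ∧ x i ≤ (pathFst m M i).card) ∧
      1 ≤ k i ∧ k i ≤ sndCard m M i (x i) := by
    intro i
    have := (hW i).1
    rwa [hxk, validIdx_pair, pathShape_nil, pathShape_singleton] at this
  have hfst : ∀ i : Fin m, v i [x i] = t i.castSucc := by
    intro i
    have := ht i 0 i.castSucc (by rw [attrList_pathAttrs]; rfl)
    rwa [hxk] at this
  have hsnd : ∀ i : Fin m, v i [x i, k i] = t i.succ := by
    intro i
    have := ht i 1 i.succ (by rw [attrList_pathAttrs]; rfl)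
    rwa [hxk] at this
  refine no_interval_path hm hM
    (fun i => if h : i < m then nthVal (pathFst m M i) (x ⟨i, h⟩) else 0) ?_ ?_
  · intro i hi
    simp only [dif_pos hi]
    exact nthVal_mem _ (hval ⟨i, hi⟩).1.1 (hval ⟨i, hi⟩).1.2
  · intro i hi
    have hi' : i < m := by omega
    simp only [dif_pos hi, dif_pos hi']
    obtain ⟨⟨hx1, hx2⟩, hk1, hk2⟩ := hval ⟨i, hi'⟩
    obtain ⟨⟨hy1, hy2⟩, -, -⟩ := hval ⟨i + 1, hi⟩
    have hpos := hk1.trans hk2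
    exact ⟨sndMin m M i (x ⟨i, hi'⟩), nthVal_mem _ le_rfl hpos,
      sndMax m M i (x ⟨i, hi'⟩), nthVal_mem _ hpos le_rfl,
      nthVal_mem_range_of_satComp hv hsat ⟨i, hi'⟩ hi hx1 hx2 hk1 hk2 hy1 hy2
        ((hsnd _).trans (hfst ⟨i + 1, hi⟩).symm)⟩

lemma isCert_pathCert {m M : ℕ} (hm : 2 ≤ m) (hM : 2 ≤ M) :
    IsCert (pathAttrs m) (List.finRange (m + 1)) (pathShape m M) (pathCert m M) :=
  ⟨fun _ hc => compWF_pathCert hc, fun _ _ hv hv' hs hs' W =>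
    iff_of_false (not_isWitness_of_satComp hm hM hv hs W)
      (not_isWitness_of_satComp hm hM hv' hs' W)⟩

/-! ### Output and sizes -/

lemma mem_pathDB {m M : ℕ} {i : Fin m} {u : Fin (m + 1) → ℕ} (hu : u ∈ pathDB m M i) :
    (u i.castSucc, u i.succ) ∈ pathPairs m M (i + 1) := by
  obtain ⟨p, hp, rfl⟩ := Finset.mem_image.1 hu
  have hne : i.succ ≠ i.castSucc := (Fin.castSucc_lt_succ).ne'
  simpa [hne] using hp

lemma pathDB_output_empty {m M : ℕ} (hm : 2 ≤ m) (hM : 2 ≤ M) :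
    ¬ ∃ t : Fin (m + 1) → ℕ, ∀ i : Fin m,
      ∃ u ∈ pathDB m M i, u i.castSucc = t i.castSucc ∧ u i.succ = t i.succ := by
  rintro ⟨t, ht⟩
  have hmem : ∀ i (hi : i < m), (t ⟨i, by omega⟩, t ⟨i + 1, by omega⟩)
      ∈ pathPairs m M (i + 1) := by
    intro i hi
    obtain ⟨u, hu, h1, h2⟩ := ht ⟨i, hi⟩
    have := mem_pathDB hu
    rwa [h1, h2] at this
  refine no_interval_path hm hM (fun i => if h : i < m + 1 then t ⟨i, h⟩ else 0) ?_ ?_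
  · intro i hi
    simp only [dif_pos (show i < m + 1 by omega)]
    exact mem_pathFst.2 ⟨_, hmem i hi⟩
  · intro i hi
    simp only [dif_pos (show i < m + 1 by omega), dif_pos (show i + 1 < m + 1 by omega)]
    have := mem_pathSnd.2 (hmem i (by omega))
    exact ⟨_, this, _, this, le_rfl, le_rfl⟩

lemma card_pathDB {m M : ℕ} (i : Fin m) :
    (pathDB m M i).card = (pathPairs m M (i + 1)).card := by
  refine Finset.card_image_of_injective _ fun p q h => ?_
  have hne : i.succ ≠ i.castSucc := (Fin.castSucc_lt_succ).ne'
  have h1 := congrFun h i.castSucc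
  have h2 := congrFun h i.succ
  simp only [if_true, if_neg hne] at h1 h2
  exact Prod.ext h1 h2

lemma card_chunkBlock {M j : ℕ} (hj : 1 ≤ j) :
    (chunkBlock M j).card = (M - 1) * (M - 1) := by
  obtain ⟨k, rfl⟩ : ∃ k, j = k + 1 := ⟨j - 1, by omega⟩
  rw [chunkBlock, Finset.card_product, Nat.card_Icc, Nat.add_sub_cancel, Nat.succ_mul]
  congr 1 <;> omega

lemma disjoint_chunkBlock {M j l : ℕ} (hj : 1 ≤ j) (hl : 1 ≤ l) (hjl : j ≠ l) :
    Disjoint (chunkBlock M j) (chunkBlock M l) := by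
  obtain ⟨a, rfl⟩ : ∃ a, j = a + 1 := ⟨j - 1, by omega⟩
  obtain ⟨b, rfl⟩ : ∃ b, l = b + 1 := ⟨l - 1, by omega⟩
  rw [Finset.disjoint_left]
  rintro ⟨p, q⟩ h1 h2
  simp only [chunkBlock, Finset.mem_product, Finset.mem_Icc, Nat.add_sub_cancel,
    Nat.succ_mul] at h1 h2
  have := chunk_unique (M := M) (k := a) (l := b) (p := p)
    (by omega) (by omega) (by omega) (by omega)
  omega

lemma le_card_pathPairs (m M i : ℕ) :
    (m - 2) * (M - 1) * (M - 1) ≤ (pathPairs m M i).card := by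
  refine le_trans ?_ (Finset.card_le_card Finset.subset_union_left)
  rw [Finset.card_biUnion, Finset.sum_congr rfl
    (g := fun _ => (M - 1) * (M - 1)), Finset.sum_const, smul_eq_mul, mul_assoc]
  · refine Nat.mul_le_mul_right _ ?_
    have hsub : Finset.Icc 1 m \ {i, if i = 1 then m else i - 1} ⊆ (Finset.Icc 1 m).filter
        (fun j => j ≠ i ∧ j ≠ (if i = 1 then m else i - 1)) := by
      intro j hj
      simpa only [Finset.mem_sdiff, Finset.mem_filter, Finset.mem_insert, Finset.mem_singleton,
        not_or] using hj
    refine le_trans ?_ (Finset.card_le_card hsub)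
    refine le_trans ?_ (Finset.le_card_sdiff _ _)
    rw [Nat.card_Icc, Nat.add_sub_cancel]
    exact Nat.sub_le_sub_left Finset.card_le_two m
  · intro j hj
    exact card_chunkBlock (Finset.mem_Icc.1 (Finset.mem_filter.1 hj).1).1
  · intro j hj l hl hjl
    exact disjoint_chunkBlock (Finset.mem_Icc.1 (Finset.mem_filter.1 hj).1).1
      (Finset.mem_Icc.1 (Finset.mem_filter.1 hl).1).1 hjl

lemma card_pathPairs_le {m M : ℕ} (hm : 1 ≤ m) (hM : 1 ≤ M) (i : ℕ) :
    (pathPairs m M i).card ≤ m * M * M := by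
  have hcard : (pathPairs m M i).card ≤ m * ((M - 1) * (M - 1)) + 1 := by
    refine (Finset.card_union_le _ _).trans ?_
    rw [Finset.card_singleton]
    refine Nat.add_le_add_right ?_ 1
    refine (Finset.card_biUnion_le_card_mul _ _ ((M - 1) * (M - 1)) fun j hj => ?_).trans ?_
    · exact (card_chunkBlock (Finset.mem_Icc.1 (Finset.mem_filter.1 hj).1).1).le
    · refine Nat.mul_le_mul_right _ ((Finset.card_filter_le _ _).trans ?_)
      simp
  refine hcard.trans ?_
  obtain ⟨N, rfl⟩ : ∃ N, M = N + 1 := ⟨M - 1, by omega⟩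
  rw [Nat.add_sub_cancel]
  nlinarith [Nat.zero_le (m * N)]

/-- For the path query `⋈_{i=1}^m R_i(A_i, A_{i+1})` (GAO `A_1, …, A_{m+1}`) on the chunked
instance with `m ≥ 5`, `M ≥ 2`: (a) the output is empty; (b) the instance admits a
certificate of size at most `c ⬝ m² ⬝ M` for an absolute constant `c`; (c) even though every
relation has `Θ(mM²)` tuples. -/
theorem stmt_11 :
    ∃ c : ℕ, 0 < c ∧ ∀ m M : ℕ, 5 ≤ m → 2 ≤ M →
      -- (a) the output of the join is empty
      (¬ ∃ t : Fin (m + 1) → ℕ, ∀ i : Fin m,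
        ∃ u ∈ pathDB m M i, u i.castSucc = t i.castSucc ∧ u i.succ = t i.succ) ∧
      -- (b) there is a certificate of size at most `c ⬝ m² ⬝ M`
      (∃ A : Finset (Comp (Fin m)),
        IsCert (pathAttrs m) (List.finRange (m + 1))
          (dbShape (pathAttrs m) (List.finRange (m + 1)) (pathDB m M)) A ∧
        (∀ cc ∈ A, SatComp (dbValue (pathAttrs m) (List.finRange (m + 1)) (pathDB m M)) cc) ∧
        A.card ≤ c * m ^ 2 * M) ∧
      -- (c) every relation has `Θ(m M²)` tuples
      (∀ i : Fin m, (m - 2) * (M - 1) * (M - 1) ≤ (pathDB m M i).card ∧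
        (pathDB m M i).card ≤ m * M * M) := by
  refine ⟨2, by norm_num, fun m M hm hM => ⟨pathDB_output_empty (by omega) hM,
    ⟨pathCert m M, isCert_pathCert (by omega) hM, fun _ hc => satComp_pathCert hc,
      card_pathCert_le (by omega)⟩, fun i => ?_⟩⟩
  rw [card_pathDB]
  exact ⟨le_card_pathPairs m M _, card_pathPairs_le (by omega) (by omega) _⟩
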